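/- (Kreĭn) Let T be a symmetric contraction defined on a closed subspace dom(T) of a complex Hilbert space H, and let ℬ(T) be the set of everywhere-defined selfadjoint contractions on H extending T. Then ℬ(T) ≠ ∅, and there exist T̃₋₁, T̃₁ ∈ ℬ(T) with T̃₋₁ ≤ T̃₁ such that for any bounded operator B on H: B ∈ ℬ(T) if and only if B = B* and T̃₋₁ ≤ B ≤ T̃₁. -/

import Mathlib

open scoped InnerProductSpace ComplexOrder
open Filter Topology

noncomputable section

variable {H : Type*} [NormedAddCommGroup H] [InnerProductSpace ℂ H] [CompleteSpace H]

/-- **Douglas lemma**: an operator dominated in norm by `S` factors as `K ∘ S` for a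
contraction `K`. -/
theorem exists_contraction_comp_eq {E F G : Type*}
    [NormedAddCommGroup E] [InnerProductSpace ℂ E]
    [NormedAddCommGroup F] [InnerProductSpace ℂ F] [CompleteSpace F]
    [NormedAddCommGroup G] [InnerProductSpace ℂ G] [CompleteSpace G]
    (f : E →L[ℂ] F) (S : E →L[ℂ] G) (h : ∀ x, ‖f x‖ ≤ ‖S x‖) :
    ∃ K : G →L[ℂ] F, (∀ x, K (S x) = f x) ∧ ∀ y, ‖K y‖ ≤ ‖y‖ := by
  set M : Submodule ℂ G := S.toLinearMap.range.topologicalClosure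
  have : CompleteSpace M :=
    S.toLinearMap.range.isClosed_topologicalClosure.completeSpace_coe
  have hmem : ∀ x, S x ∈ M := fun x =>
    S.toLinearMap.range.le_topologicalClosure ⟨x, rfl⟩
  set e : E →ₗ[ℂ] M := S.toLinearMap.codRestrict M hmem
  have hdense : DenseRange e := by
    rw [DenseRange, Subtype.dense_iff]
    have : (Subtype.val '' Set.range e) = (S.toLinearMap.range : Set G) := by
      ext y
      simp [e]
    exact fun y hy => closure_mono this.ge hy
  have hnorm : ∀ x, ‖f.toLinearMap x‖ ≤ 1 * ‖e x‖ := fun x => by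
    rw [one_mul]
    exact h x
  refine ⟨(f.toLinearMap.extendOfNorm e).comp M.orthogonalProjectionOnto, fun x => ?_, fun y => ?_⟩
  · have hx : M.orthogonalProjectionOnto (S x) = e x :=
      M.orthogonalProjectionOnto_mem_subspace_eq_self (e x)
    simp only [ContinuousLinearMap.comp_apply, hx]
    exact LinearMap.extendOfNorm_eq hdense ⟨1, hnorm⟩ x
  · calc ‖(f.toLinearMap.extendOfNorm e) (M.orthogonalProjectionOnto y)‖
        ≤ 1 * ‖M.orthogonalProjectionOnto y‖ :=
          LinearMap.norm_extendOfNorm_apply_le hdense 1 hnorm _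
      _ ≤ ‖y‖ := by
          rw [one_mul]
          exact M.norm_orthogonalProjectionOnto_apply_le y

/-- For selfadjoint operators, `A ≤ B` is nonnegativity of the quadratic form of `B - A`. -/
theorem le_iff_forall_inner_nonneg {E : Type*} [NormedAddCommGroup E] [InnerProductSpace ℂ E]
    (A B : E →L[ℂ] E) : A ≤ B ↔ ∀ ξ : E, 0 ≤ ⟪(B - A) ξ, ξ⟫_ℂ := by
  rw [ContinuousLinearMap.le_def, ContinuousLinearMap.isPositive_iff_complex]
  refine forall_congr' fun ξ => ?_
  rw [← RCLike.ofReal_nonneg (K := ℂ)]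
  constructor
  · rintro ⟨h1, h2⟩
    exact h2.trans_eq h1
  · intro h
    have : (RCLike.re ⟪(B - A) ξ, ξ⟫_ℂ : ℂ) = ⟪(B - A) ξ, ξ⟫_ℂ := by
      obtain ⟨-, h2⟩ := Complex.le_def.1 h
      apply Complex.ext
      · simp
      · simpa using h2
    exact ⟨this, by rwa [← this] at h⟩

/-- A selfadjoint operator is a contraction iff it lies between `-1` and `1`. -/
theorem IsSelfAdjoint.norm_le_one_iff_neg_one_le_and_le_one {B : H →L[ℂ] H}
    (hB : IsSelfAdjoint B) : ‖B‖ ≤ 1 ↔ -1 ≤ B ∧ B ≤ 1 := by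
  constructor
  · intro h
    have hle : algebraMap ℝ (H →L[ℂ] H) ‖B‖ ≤ 1 := by
      simpa using algebraMap_mono (H →L[ℂ] H) h
    exact ⟨(neg_le_neg hle).trans hB.neg_algebraMap_norm_le_self,
      hB.le_algebraMap_norm_self.trans hle⟩
  · rintro ⟨h1, h2⟩
    have h1' : 0 ≤ 1 + B := by simpa [add_comm] using sub_nonneg.2 h1
    have h2' : 0 ≤ 1 - B := sub_nonneg.2 h2
    have e1 : 0 ≤ (1 - B) * (1 + B) * (1 - B) :=
      ((IsSelfAdjoint.one _).sub hB).conjugate_nonneg h1'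
    have e2 : 0 ≤ (1 + B) * (1 - B) * (1 + B) :=
      ((IsSelfAdjoint.one _).add hB).conjugate_nonneg h2'
    have e3 : (0 : H →L[ℂ] H) ≤ (2 : ℝ)⁻¹ • ((1 - B) * (1 + B) * (1 - B) +
        (1 + B) * (1 - B) * (1 + B)) := smul_nonneg (by norm_num) (add_nonneg e1 e2)
    have e4 : (1 - B) * (1 + B) * (1 - B) + (1 + B) * (1 - B) * (1 + B)
        = (2 : ℝ) • (1 - B * B) := by
      rw [two_smul]
      noncomm_ring
    rw [e4, smul_smul, inv_mul_cancel₀ two_ne_zero, one_smul, sub_nonneg] at e3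
    have e5 : ‖B * B‖ ≤ 1 :=
      (CStarAlgebra.norm_le_one_iff_of_nonneg _ hB.mul_self_nonneg).2 e3
    rw [hB.norm_mul_self] at e5
    exact (sq_le_one_iff₀ (norm_nonneg _)).1 e5

/-- A positive operator dominated by an operator vanishing at `x` vanishes at `x`. -/
theorem apply_eq_zero_of_nonneg_of_le {X Y : H →L[ℂ] H} (hX : 0 ≤ X) (hXY : X ≤ Y) {x : H}
    (hx : Y x = 0) : X x = 0 := by
  set R := CFC.sqrt X
  have hR : IsSelfAdjoint R := (CFC.sqrt_nonneg X).isSelfAdjoint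
  have hRR : R * R = X := CFC.sqrt_mul_sqrt_self X hX
  have h1 : 0 ≤ ⟪(Y - X) x, x⟫_ℂ := (le_iff_forall_inner_nonneg X Y).1 hXY x
  have h2 : ⟪X x, x⟫_ℂ = ⟪R x, R x⟫_ℂ := by
    rw [← hRR]
    exact hR.isSymmetric (R x) x
  have h3 : ‖R x‖ ^ 2 ≤ 0 := by
    rw [sub_apply, hx, zero_sub, inner_neg_left, h2,
      inner_self_eq_norm_sq_to_K] at h1
    have h4 : (0 : ℂ) ≤ ((-‖R x‖ ^ 2 : ℝ) : ℂ) := by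
      push_cast
      exact h1
    linarith [Complex.zero_le_real.1 h4]
  have h4 : R x = 0 := by
    rw [← norm_eq_zero]
    exact pow_eq_zero_iff two_ne_zero |>.1 (le_antisymm h3 (sq_nonneg _))
  rw [← hRR, mul_apply_eq_comp, h4, map_zero]

/-- **Kreĭn's shorted operator**: among the selfadjoint operators dominated by a positive
operator `P` and vanishing on `D` there is a greatest one, and it is positive. -/
theorem exists_shorted_operator (D : Submodule ℂ H) {P : H →L[ℂ] H} (hP : 0 ≤ P) :
    ∃ S : H →L[ℂ] H, 0 ≤ S ∧ S ≤ P ∧ (∀ d ∈ D, S d = 0) ∧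
      ∀ C : H →L[ℂ] H, IsSelfAdjoint C → (∀ d ∈ D, C d = 0) → C ≤ P → C ≤ S := by
  set R := CFC.sqrt P
  have hR : IsSelfAdjoint R := (CFC.sqrt_nonneg P).isSelfAdjoint
  have hRR : R * R = P := CFC.sqrt_mul_sqrt_self P hP
  set N : Submodule ℂ H := D.map R.toLinearMap
  set Q : H →L[ℂ] H := Nᗮ.starProjection
  have hQ : IsStarProjection Q := isStarProjection_starProjection
  refine ⟨R * Q * R, hR.conjugate_nonneg hQ.nonneg, ?_, ?_, ?_⟩
  · have := hR.conjugate_nonneg hQ.one_sub.nonneg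
    rw [← sub_nonneg]
    rwa [mul_sub, sub_mul, mul_one, hRR] at this
  · intro d hd
    have : Q (R d) = 0 := by
      rw [Submodule.starProjection_apply_eq_zero_iff]
      exact N.le_orthogonal_orthogonal ⟨d, hd, rfl⟩
    simp [this]
  · intro C hC hCD hCP
    rw [ContinuousLinearMap.le_def, ContinuousLinearMap.isPositive_def']
    refine ⟨((hR.conjugate_nonneg hQ.nonneg).isSelfAdjoint).sub hC, fun ξ => ?_⟩
    have key : ∀ y ∈ closure (N : Set H), RCLike.re ⟪C ξ, ξ⟫_ℂ ≤ ‖R ξ - y‖ ^ 2 := by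
      refine closure_minimal (t := {y | RCLike.re ⟪C ξ, ξ⟫_ℂ ≤ ‖R ξ - y‖ ^ 2}) ?_
        (isClosed_le continuous_const (by fun_prop))
      rintro _ ⟨d, hd, rfl⟩
      have h1 : ⟪C (ξ - d), ξ - d⟫_ℂ = ⟪C ξ, ξ⟫_ℂ := by
        have : ⟪C ξ, d⟫_ℂ = ⟪ξ, C d⟫_ℂ := hC.isSymmetric ξ d
        rw [map_sub, hCD d hd, sub_zero, inner_sub_right, this, hCD d hd, inner_zero_right,
          sub_zero]
      have h2 : ⟪P (ξ - d), ξ - d⟫_ℂ = ⟪R (ξ - d), R (ξ - d)⟫_ℂ := by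
        rw [← hRR]
        exact hR.isSymmetric _ _
      have h3 := (ContinuousLinearMap.le_def C P).1 hCP |>.re_inner_nonneg_left (ξ - d)
      rw [sub_apply, inner_sub_left, h1, h2, map_sub,
        inner_self_eq_norm_sq, sub_nonneg, map_sub] at h3
      exact h3
    have hmem : R ξ - Q (R ξ) ∈ closure (N : Set H) := by
      rw [← Submodule.topologicalClosure_coe, ← Submodule.orthogonal_orthogonal_eq_closure]
      exact Nᗮ.sub_starProjection_mem_orthogonal (R ξ)
    have h := key _ hmem
    rw [sub_sub_cancel] at h
    have h4 : ⟪(R * Q * R) ξ, ξ⟫_ℂ = ⟪Q (R ξ), Q (R ξ)⟫_ℂ := by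
      have e1 : ⟪R (Q (R ξ)), ξ⟫_ℂ = ⟪Q (R ξ), R ξ⟫_ℂ := hR.isSymmetric _ _
      have e2 : ⟪Q (Q (R ξ)), R ξ⟫_ℂ = ⟪Q (R ξ), Q (R ξ)⟫_ℂ :=
        hQ.isSelfAdjoint.isSymmetric _ _
      have e3 : Q (Q (R ξ)) = Q (R ξ) := congrArg (fun A : H →L[ℂ] H => A (R ξ)) hQ.isIdempotentElem
      rw [e3] at e2
      exact e1.trans e2
    rw [ContinuousLinearMap.reApplyInnerSelf_apply, sub_apply,
      inner_sub_left, h4, map_sub, inner_self_eq_norm_sq, sub_nonneg]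
    exact h

/-- The defect operator `(1 - a²)^(1/2)` of a selfadjoint contraction `a`. -/
theorem exists_defect_operator {a : H →L[ℂ] H} (ha : IsSelfAdjoint a) (ha1 : ‖a‖ ≤ 1) :
    ∃ s : H →L[ℂ] H, IsSelfAdjoint s ∧ Commute s a ∧ ∀ x, ‖s x‖ ^ 2 + ‖a x‖ ^ 2 = ‖x‖ ^ 2 := by
  have hpos : 0 ≤ 1 - a * a := by
    rw [sub_nonneg]
    refine (CStarAlgebra.norm_le_one_iff_of_nonneg (a * a) ha.mul_self_nonneg).1 ?_
    rw [ha.norm_mul_self]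
    exact pow_le_one₀ (norm_nonneg _) ha1
  set s : H →L[ℂ] H := CFC.sqrt (1 - a * a)
  have hs : IsSelfAdjoint s := (CFC.sqrt_nonneg _).isSelfAdjoint
  have hss : s * s = 1 - a * a := CFC.sqrt_mul_sqrt_self _ hpos
  have hcomm : Commute s a := by
    have h : Commute (1 - a * a) a :=
      (Commute.one_left a).sub_left ((Commute.refl a).mul_left (Commute.refl a))
    exact h.cfcₙ_nnreal _
  refine ⟨s, hs, hcomm, fun x => ?_⟩
  have e1 : ⟪s (s x), x⟫_ℂ = ⟪s x, s x⟫_ℂ := hs.isSymmetric _ _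
  have e2 : ⟪a (a x), x⟫_ℂ = ⟪a x, a x⟫_ℂ := ha.isSymmetric _ _
  have e3 : s (s x) = x - a (a x) := congrArg (fun A : H →L[ℂ] H => A x) hss
  rw [e3, inner_sub_left, e2] at e1
  have := congrArg RCLike.re e1
  rw [map_sub, inner_self_eq_norm_sq, inner_self_eq_norm_sq, inner_self_eq_norm_sq] at this
  linarith

/-- Every symmetric contraction on a closed subspace has a selfadjoint contractive extension. -/
theorem exists_selfAdjoint_contraction_extension (D : Submodule ℂ H) [CompleteSpace D]
    (T : D →L[ℂ] H) (hcontr : ∀ ξ : D, ‖T ξ‖ ≤ ‖(ξ : H)‖)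
    (hsymm : ∀ ξ η : D, ⟪T ξ, (η : H)⟫_ℂ = ⟪(ξ : H), T η⟫_ℂ) :
    ∃ A : H →L[ℂ] H, IsSelfAdjoint A ∧ ‖A‖ ≤ 1 ∧ ∀ ξ : D, A ξ = T ξ := by
  set P : H →L[ℂ] D := D.orthogonalProjectionOnto
  set P' : H →L[ℂ] Dᗮ := Dᗮ.orthogonalProjectionOnto
  set a : D →L[ℂ] D := P.comp T
  have ha : IsSelfAdjoint a := by
    rw [ContinuousLinearMap.isSelfAdjoint_iff_isSymmetric]
    intro x y
    change ⟪P (T x), y⟫_ℂ = ⟪x, P (T y)⟫_ℂ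
    rw [D.inner_orthogonalProjectionOnto_eq_of_mem_right,
      D.inner_orthogonalProjectionOnto_eq_of_mem_left, hsymm]
  have hpyth : ∀ v : H, ‖v‖ ^ 2 = ‖P v‖ ^ 2 + ‖P' v‖ ^ 2 := fun v =>
    Submodule.norm_sq_eq_add_norm_sq_projection v D
  have ha1 : ‖a‖ ≤ 1 := ContinuousLinearMap.opNorm_le_bound _ zero_le_one fun x => by
    rw [one_mul]
    exact (D.norm_orthogonalProjectionOnto_apply_le _).trans (hcontr x)
  obtain ⟨s, hs, hcomm, hs_norm⟩ := exists_defect_operator ha ha1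
  obtain ⟨K, hK, hK1⟩ := exists_contraction_comp_eq (P'.comp T) s fun x => by
    refine le_of_sq_le_sq ?_ (norm_nonneg _)
    have h1 := hpyth (T x)
    have h2 := hs_norm x
    have h3 : ‖T x‖ ^ 2 ≤ ‖x‖ ^ 2 := pow_le_pow_left₀ (norm_nonneg _) (hcontr x) 2
    change ‖P' (T x)‖ ^ 2 ≤ _
    change _ + ‖P (T x)‖ ^ 2 = _ at h2
    linarith
  have hKadj : ∀ y, ‖K.adjoint y‖ ≤ ‖y‖ := fun y => by
    have h1 : ‖K.adjoint‖ ≤ 1 := by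
      rw [LinearIsometryEquiv.norm_map]
      exact K.opNorm_le_bound zero_le_one fun x => by simpa using hK1 x
    simpa using K.adjoint.le_of_opNorm_le h1 y
  set L : H →L[ℂ] D := K.adjoint.comp P'
  set A : H →L[ℂ] H := D.subtypeL.comp (a.comp P + s.comp L) +
    Dᗮ.subtypeL.comp (K.comp (s.comp P - a.comp L))
  have hA : ∀ ξ, A ξ = (a (P ξ) + s (L ξ) : D) + (K (s (P ξ) - a (L ξ)) : H) := fun ξ => rfl
  have hinner : ∀ ξ η, ⟪A ξ, η⟫_ℂ =
      ⟪a (P ξ) + s (L ξ), P η⟫_ℂ + ⟪s (P ξ) - a (L ξ), L η⟫_ℂ := fun ξ η => by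
    have e1 : ∀ u : D, ⟪(u : H), η⟫_ℂ = ⟪u, P η⟫_ℂ := fun u =>
      (D.inner_orthogonalProjectionOnto_eq_of_mem_left u η).symm
    have e2 : ∀ v : D, ⟪(K v : H), η⟫_ℂ = ⟪v, L η⟫_ℂ := fun v => by
      rw [← Dᗮ.inner_orthogonalProjectionOnto_eq_of_mem_left]
      exact (K.adjoint_inner_right v _).symm
    rw [hA, inner_add_left, e1, e2]
  have ha_symm : ∀ x y, ⟪a x, y⟫_ℂ = ⟪x, a y⟫_ℂ := ha.isSymmetric
  have hs_symm : ∀ x y, ⟪s x, y⟫_ℂ = ⟪x, s y⟫_ℂ := hs.isSymmetric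
  have hsa : ∀ x, s (a x) = a (s x) := fun x => congrArg (fun B : D →L[ℂ] D => B x) hcomm.eq
  refine ⟨A, ?_, ?_, fun ξ => ?_⟩
  · rw [ContinuousLinearMap.isSelfAdjoint_iff_isSymmetric]
    intro ξ η
    change ⟪A ξ, η⟫_ℂ = ⟪ξ, A η⟫_ℂ
    rw [← inner_conj_symm ξ, hinner, hinner, map_add, inner_conj_symm, inner_conj_symm]
    simp only [inner_add_left, inner_add_right, inner_sub_left, inner_sub_right, ha_symm, hs_symm]
    ring
  · refine A.opNorm_le_bound zero_le_one fun ξ => ?_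
    rw [one_mul]
    refine le_of_sq_le_sq ?_ (norm_nonneg _)
    set p := P ξ
    set l := L ξ
    have h1 : ‖A ξ‖ ^ 2 = ‖a p + s l‖ ^ 2 + ‖K (s p - a l)‖ ^ 2 := by
      have horth : ⟪((a p + s l : D) : H), (K (s p - a l) : H)⟫_ℂ = 0 :=
        Submodule.inner_right_of_mem_orthogonal (a p + s l).2 (K (s p - a l)).2
      rw [hA, sq, norm_add_sq_eq_norm_sq_add_norm_sq_of_inner_eq_zero _ _ horth, ← sq, ← sq]
      rfl
    have h2 : ‖a p + s l‖ ^ 2 + ‖s p - a l‖ ^ 2 = ‖p‖ ^ 2 + ‖l‖ ^ 2 := by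
      have hcross : ⟪a p, s l⟫_ℂ = ⟪s p, a l⟫_ℂ := by
        rw [← hs_symm, hsa, ha_symm]
      rw [norm_add_sq (𝕜 := ℂ), norm_sub_sq (𝕜 := ℂ), hcross]
      linarith [hs_norm p, hs_norm l]
    have h3 : ‖K (s p - a l)‖ ^ 2 ≤ ‖s p - a l‖ ^ 2 := pow_le_pow_left₀ (norm_nonneg _) (hK1 _) 2
    have h4 : ‖l‖ ^ 2 ≤ ‖P' ξ‖ ^ 2 := pow_le_pow_left₀ (norm_nonneg _) (hKadj _) 2
    linarith [hpyth ξ]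
  · have hP : P ξ = ξ := D.orthogonalProjectionOnto_mem_subspace_eq_self ξ
    have hP' : P' ξ = 0 := D.orthogonalProjectionOnto_orthogonal_apply_eq_zero ξ.2
    have hL : L ξ = 0 := by
      change K.adjoint (P' ξ) = 0
      rw [hP', map_zero]
    rw [hA, hP, hL, map_zero, map_zero, add_zero, sub_zero, hK]
    exact D.starProjection_add_starProjection_orthogonal (T ξ)

/-- (Kreĭn) Let `T` be a symmetric contraction defined on a closed subspace `D = dom T` of a
complex Hilbert space `H`, and let `ℬ(T)` be the set of everywhere defined selfadjoint
contractions on `H` extending `T`. Then `ℬ(T) ≠ ∅`, and there exist `T̃₋₁, T̃₁ ∈ ℬ(T)` with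
`T̃₋₁ ≤ T̃₁` such that for any bounded operator `B` on `H`: `B ∈ ℬ(T)` if and only if
`B = B*` and `T̃₋₁ ≤ B ≤ T̃₁`. -/
theorem statement13 (D : Submodule ℂ H) (hD : IsClosed (D : Set H)) (T : D →L[ℂ] H)
    (hcontr : ∀ ξ : D, ‖T ξ‖ ≤ ‖(ξ : H)‖)
    (hsymm : ∀ ξ η : D, ⟪T ξ, (η : H)⟫_ℂ = ⟪(ξ : H), T η⟫_ℂ) :
    ∃ Tm T1 : H →L[ℂ] H,
      (IsSelfAdjoint Tm ∧ ‖Tm‖ ≤ 1 ∧ ∀ ξ : D, Tm ξ = T ξ) ∧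
      (IsSelfAdjoint T1 ∧ ‖T1‖ ≤ 1 ∧ ∀ ξ : D, T1 ξ = T ξ) ∧
      (∀ ξ : H, 0 ≤ ⟪(T1 - Tm) ξ, ξ⟫_ℂ) ∧
      ∀ B : H →L[ℂ] H,
        (IsSelfAdjoint B ∧ ‖B‖ ≤ 1 ∧ ∀ ξ : D, B ξ = T ξ) ↔
          (IsSelfAdjoint B ∧ (∀ ξ : H, 0 ≤ ⟪(B - Tm) ξ, ξ⟫_ℂ) ∧
            ∀ ξ : H, 0 ≤ ⟪(T1 - B) ξ, ξ⟫_ℂ) := by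
  have : CompleteSpace D := hD.completeSpace_coe
  obtain ⟨A, hA, hA1, hAT⟩ := exists_selfAdjoint_contraction_extension D T hcontr hsymm
  obtain ⟨hle, hle'⟩ := hA.norm_le_one_iff_neg_one_le_and_le_one.1 hA1
  obtain ⟨Sp, hSp0, hSp1, hSpD, hSpmax⟩ := exists_shorted_operator D (sub_nonneg.2 hle')
  obtain ⟨Sm, hSm0, hSm1, hSmD, hSmmax⟩ := exists_shorted_operator D (sub_nonneg.2 hle)
  have hTp : A + Sp ≤ 1 := le_sub_iff_add_le'.1 hSp1
  have hTm : -1 ≤ A - Sm := by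
    rw [le_sub_comm]
    exact hSm1
  have hpA : A ≤ A + Sp := le_add_of_nonneg_right hSp0
  have hmA : A - Sm ≤ A := sub_le_self _ hSm0
  have hp : IsSelfAdjoint (A + Sp) := hA.add hSp0.isSelfAdjoint
  have hm : IsSelfAdjoint (A - Sm) := hA.sub hSm0.isSelfAdjoint
  refine ⟨A - Sm, A + Sp, ⟨hm, ?_, fun ξ => ?_⟩, ⟨hp, ?_, fun ξ => ?_⟩, ?_, fun B => ?_⟩
  · exact hm.norm_le_one_iff_neg_one_le_and_le_one.2 ⟨hTm, hmA.trans hle'⟩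
  · rw [sub_apply, hSmD _ ξ.2, sub_zero, hAT]
  · exact hp.norm_le_one_iff_neg_one_le_and_le_one.2 ⟨hle.trans hpA, hTp⟩
  · rw [add_apply, hSpD _ ξ.2, add_zero, hAT]
  · exact (le_iff_forall_inner_nonneg _ _).1 (hmA.trans hpA)
  rw [← le_iff_forall_inner_nonneg, ← le_iff_forall_inner_nonneg]
  constructor
  · rintro ⟨hB, hB1, hBT⟩
    obtain ⟨hB2, hB3⟩ := hB.norm_le_one_iff_neg_one_le_and_le_one.1 hB1
    refine ⟨hB, ?_, ?_⟩
    · rw [sub_le_comm]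
      refine hSmmax _ (hA.sub hB) (fun d hd => ?_) (sub_le_sub_left hB2 A)
      rw [sub_apply, hBT ⟨d, hd⟩, hAT ⟨d, hd⟩, sub_self]
    · rw [← sub_le_iff_le_add']
      refine hSpmax _ (hB.sub hA) (fun d hd => ?_) (sub_le_sub_right hB3 A)
      rw [sub_apply, hBT ⟨d, hd⟩, hAT ⟨d, hd⟩, sub_self]
  · rintro ⟨hB, hB2, hB3⟩
    refine ⟨hB, hB.norm_le_one_iff_neg_one_le_and_le_one.2 ⟨hTm.trans hB2, hB3.trans hTp⟩,
      fun ξ => ?_⟩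
    have hd : (A + Sp - (A - Sm)) ξ = 0 := by
      simp [hSpD _ ξ.2, hSmD _ ξ.2]
    have h := apply_eq_zero_of_nonneg_of_le (sub_nonneg.2 hB2) (sub_le_sub_right hB3 _) hd
    rw [sub_apply, sub_apply, hSmD _ ξ.2, sub_zero, hAT] at h
    exact sub_eq_zero.1 h
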